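/- Let R be a commutative ring whose additive group is cyclic (so R is finite or R = ℤ), let 𝐑 = R[u₁^{±1}, …, u_d^{±1}] be the ring of Laurent polynomials in d commuting variables with coefficients in R, and let ℳ be a finitely generated 𝐑-module, considered as a countable discrete abelian group with compact Pontryagin dual X^ℳ. For 𝐧 = (n₁, …, n_d) ∈ ℤ^d let α_𝐧 be the automorphism of X^ℳ dual to multiplication by u₁^{n₁}⋯u_d^{n_d} on ℳ. Then: (1) the ℤ^d-action {α_𝐧 : 𝐧 ∈ ℤ^d} has DCC on X^ℳ; (2) if Γ is a finitely generated abelian group of invertible 𝐑-module homomorphisms of ℳ whose dual action on X^ℳ is ergodic, then there is α ∈ Γ whose dual automorphism is ergodic on X^ℳ. -/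

import Mathlib

open MeasureTheory Topology Set

set_option linter.unusedVariables false

namespace ErgZd

variable {K : Type*}

/-- The group of bi-continuous automorphisms of a topological group,
as a subgroup of `MulAut K`. -/
def ContAut (K : Type*) [Group K] [TopologicalSpace K] : Subgroup (MulAut K) where
  carrier := {α | Continuous α ∧ Continuous α.symm}
  one_mem' := ⟨continuous_id, continuous_id⟩
  mul_mem' := fun {a b} ha hb => ⟨ha.1.comp hb.1, hb.2.comp ha.2⟩
  inv_mem' := fun {a} ha => ⟨ha.2, ha.1⟩

section Defs

variable [Group K] [TopologicalSpace K]

lemma ContAut.continuous (α : ↥(ContAut K)) : Continuous ⇑(α : MulAut K) := α.2.1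

lemma ContAut.continuous_symm (α : ↥(ContAut K)) :
    Continuous ⇑(α : MulAut K).symm := α.2.2

/-- Ergodicity of the action of a set `S` of automorphisms with respect to `μ`:
every invariant Borel set is null or conull. -/
def ErgSet [MeasurableSpace K] (μ : Measure K) (S : Set ↥(ContAut K)) : Prop :=
  ∀ A : Set K, MeasurableSet A → (∀ α ∈ S, (α : MulAut K) '' A = A) → μ A = 0 ∨ μ A = 1

/-- Ergodicity of a single automorphism: ergodicity of the group of its integer powers. -/
def ErgAut [MeasurableSpace K] (μ : Measure K) (α : ↥(ContAut K)) : Prop :=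
  ErgSet μ (Set.range fun n : ℤ => α ^ n)

/-- Distality of the action of a set of automorphisms: for `x ≠ 1`, the identity is
not in the closure of the orbit of `x`. -/
def DistalSet (S : Set ↥(ContAut K)) : Prop :=
  ∀ x : K, x ≠ 1 → (1 : K) ∉ closure ((fun α : ↥(ContAut K) => (α : MulAut K) x) '' S)

/-- Distality of a single automorphism. -/
def DistalAut (α : ↥(ContAut K)) : Prop := DistalSet (Set.range fun n : ℤ => α ^ n)

/-- The descending chain condition for an action: every decreasing
sequence of closed invariant subgroups is eventually constant. -/
def HasDCC (S : Set ↥(ContAut K)) : Prop :=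
  ∀ C : ℕ → Subgroup K, (∀ n, IsClosed (C n : Set K)) → (∀ n, C (n + 1) ≤ C n) →
    (∀ n, ∀ α ∈ S, ∀ x, x ∈ C n ↔ (α : MulAut K) x ∈ C n) → ∃ N, ∀ n, N ≤ n → C n = C N

/-- Restriction of an automorphism to an invariant subgroup. -/
def restrictAut (H : Subgroup K) (α : ↥(ContAut K))
    (h : ∀ x, x ∈ H ↔ (α : MulAut K) x ∈ H) : ↥(ContAut ↥H) := by
  refine ⟨⟨⟨fun x => ⟨(α : MulAut K) x, (h x).mp x.2⟩,
      fun x => ⟨(α : MulAut K).symm x, (h _).mpr (by simpa using x.2)⟩, ?_, ?_⟩, ?_⟩, ?_, ?_⟩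
  · intro x; ext; simp
  · intro x; ext; simp
  · intro x y; ext; simp
  · exact Continuous.subtype_mk ((ContAut.continuous α).comp continuous_subtype_val) _
  · exact Continuous.subtype_mk ((ContAut.continuous_symm α).comp continuous_subtype_val) _

@[simp] lemma restrictAut_coe (H : Subgroup K) (α : ↥(ContAut K))
    (h : ∀ x, x ∈ H ↔ (α : MulAut K) x ∈ H) (x : ↥H) :
    ((((restrictAut H α h) : MulAut ↥H) x : ↥H) : K) = (α : MulAut K) (x : K) := rfl

/-- The automorphism induced on the quotient by an invariant closed normal subgroup. -/
def quotAut (N : Subgroup K) [N.Normal] (α : ↥(ContAut K))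
    (h : ∀ x, x ∈ N ↔ (α : MulAut K) x ∈ N) : ↥(ContAut (K ⧸ N)) := by
  have hmap : N.map ((α : MulAut K) : K ≃* K) = N := by
    ext y
    constructor
    · rintro ⟨x, hx, rfl⟩; exact (h x).mp hx
    · intro hy
      exact ⟨(α : MulAut K).symm y, (h _).mpr (by simpa using hy), by simp⟩
  refine ⟨QuotientGroup.congr N N ((α : MulAut K) : K ≃* K) hmap, ?_, ?_⟩
  · apply (QuotientGroup.isQuotientMap_mk N).continuous_iff.mpr
    have : ⇑(QuotientGroup.congr N N ((α : MulAut K) : K ≃* K) hmap) ∘ (QuotientGroup.mk : K → K ⧸ N)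
        = (QuotientGroup.mk : K → K ⧸ N) ∘ ⇑(α : MulAut K) := by
      funext x
      exact QuotientGroup.congr_mk N N _ hmap x
    rw [this]
    exact QuotientGroup.continuous_mk.comp (ContAut.continuous α)
  · apply (QuotientGroup.isQuotientMap_mk N).continuous_iff.mpr
    have : ⇑(QuotientGroup.congr N N ((α : MulAut K) : K ≃* K) hmap).symm ∘ (QuotientGroup.mk : K → K ⧸ N)
        = (QuotientGroup.mk : K → K ⧸ N) ∘ ⇑((α : MulAut K) : K ≃* K).symm := by
      funext x
      rfl
    rw [this]
    exact QuotientGroup.continuous_mk.comp (ContAut.continuous_symm α)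

end Defs

section Dual

variable (A : Type*) [CommGroup A] [TopologicalSpace A]

/-- A bi-continuous automorphism of `A`, as a continuous monoid homomorphism. -/
def ContAut.toCMH (e : ↥(ContAut A)) : ContinuousMonoidHom A A :=
  ⟨(((e : MulAut A) : A ≃* A) : A →* A), ContAut.continuous e⟩

/-- The dual automorphism `χ ↦ χ ∘ e⁻¹` of the Pontryagin dual induced by a
bi-continuous automorphism `e` of `A`. -/
noncomputable def dualAut (e : ↥(ContAut A)) : ↥(ContAut (PontryaginDual A)) := by
  refine ⟨⟨⟨⇑(PontryaginDual.map (ContAut.toCMH A e⁻¹)),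
      ⇑(PontryaginDual.map (ContAut.toCMH A e)), ?_, ?_⟩, ?_⟩, ?_, ?_⟩
  · intro χ
    refine DFunLike.ext _ _ fun y => ?_
    exact congrArg χ (MulEquiv.symm_apply_apply ((e : MulAut A) : A ≃* A) y)
  · intro χ
    refine DFunLike.ext _ _ fun y => ?_
    exact congrArg χ (MulEquiv.apply_symm_apply ((e : MulAut A) : A ≃* A) y)
  · intro χ ρ
    exact map_mul (PontryaginDual.map (ContAut.toCMH A e⁻¹)) χ ρ
  · exact (PontryaginDual.map (ContAut.toCMH A e⁻¹)).continuous_toFun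
  · exact (PontryaginDual.map (ContAut.toCMH A e)).continuous_toFun

end Dual

section Laurent

variable (R : Type*) [CommRing R] (d : ℕ)
variable (M : Type*) [AddCommGroup M] [Module (AddMonoidAlgebra R (Fin d → ℤ)) M]

/-- Multiplication by the Laurent monomial `u^𝐧` (realising the Laurent polynomial ring
`R[u₁^{±1}, …, u_d^{±1}]` as the group algebra of `ℤ^d` over `R`) as an additive
automorphism of the module `ℳ`. -/
noncomputable def monomialAddEquiv (nv : Fin d → ℤ) : M ≃+ M where
  toFun a := (AddMonoidAlgebra.single nv (1 : R) : AddMonoidAlgebra R (Fin d → ℤ)) • a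
  invFun a := (AddMonoidAlgebra.single (-nv) (1 : R) : AddMonoidAlgebra R (Fin d → ℤ)) • a
  left_inv a := by
    show AddMonoidAlgebra.single (-nv) (1 : R) • AddMonoidAlgebra.single nv (1 : R) • a = a
    rw [← mul_smul, AddMonoidAlgebra.single_mul_single]
    simp [← AddMonoidAlgebra.one_def]
  right_inv a := by
    show AddMonoidAlgebra.single nv (1 : R) • AddMonoidAlgebra.single (-nv) (1 : R) • a = a
    rw [← mul_smul, AddMonoidAlgebra.single_mul_single]
    simp [← AddMonoidAlgebra.one_def]
  map_add' a b := smul_add _ a b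

variable [TopologicalSpace M] [DiscreteTopology M]

/-- Multiplication by the Laurent monomial `u^𝐧` as a bi-continuous automorphism of
the discrete group `ℳ`, written multiplicatively. -/
noncomputable def monomialContAut (nv : Fin d → ℤ) : ↥(ContAut (Multiplicative M)) :=
  ⟨AddEquiv.toMultiplicative (monomialAddEquiv R d M nv),
    continuous_of_discreteTopology, continuous_of_discreteTopology⟩

/-- An `𝐑`-module automorphism of `ℳ` as a bi-continuous automorphism of the discrete
group `ℳ`, written multiplicatively. -/
noncomputable def moduleContAut (φ : M ≃ₗ[AddMonoidAlgebra R (Fin d → ℤ)] M) :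
    ↥(ContAut (Multiplicative M)) :=
  ⟨AddEquiv.toMultiplicative φ.toAddEquiv,
    continuous_of_discreteTopology, continuous_of_discreteTopology⟩

end Laurent

/-- A finitely generated abelian group has an element that is non-torsion modulo each of
finitely many given subgroups of infinite index. -/
lemma exists_forall_pow_notMem {G ι : Type*} [CommGroup G] [Group.FG G] (s : Finset ι)
    (N : ι → Subgroup G) (hN : ∀ i ∈ s, ¬ (N i).FiniteIndex) :
    ∃ g : G, ∀ i ∈ s, ∀ k : ℕ, 0 < k → g ^ k ∉ N i := by
  by_contra! hcon
  obtain ⟨i, hi, hfin⟩ := Subgroup.exists_finiteIndex_of_leftCoset_cover (s := s)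
    (g := fun _ => (1 : G))
    (H := fun i => (CommGroup.torsion (G ⧸ N i)).comap (QuotientGroup.mk' (N i))) <| by
      refine eq_univ_of_forall fun g => ?_
      obtain ⟨i, hi, k, hk, hg⟩ := hcon g
      exact mem_iUnion₂.2 ⟨i, hi, g,
        isOfFinOrder_iff_pow_eq_one.2 ⟨k, hk, (QuotientGroup.eq_one_iff _).2 hg⟩, one_mul g⟩
  refine hN i hi (Subgroup.finiteIndex_iff_finite_quotient.2 ?_)
  refine CommGroup.finite_of_fg_isMulTorsion _ fun x => ?_
  obtain ⟨g, rfl⟩ := QuotientGroup.mk_surjective x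
  have hg := Subgroup.pow_index_mem
    ((CommGroup.torsion (G ⧸ N i)).comap (QuotientGroup.mk' (N i))) g
  exact IsOfFinOrder.of_pow (show IsOfFinOrder ((g : G ⧸ N i) ^ _) from hg) hfin.index_ne_zero

/-- If a finitely generated abelian group acts linearly on a finite module over a Noetherian ring
without nonzero finite orbits, then one of its elements has no nonzero periodic points. -/
lemma exists_forall_pow_apply_ne {A M G : Type*} [CommRing A] [IsNoetherianRing A]
    [AddCommGroup M] [Module A M] [Module.Finite A M] [CommGroup G] [Group.FG G]
    (ρ : G →* Module.End A M)
    (hρ : ∀ x : M, x ≠ 0 → (range fun g => ρ g x).Infinite) :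
    ∃ g : G, ∀ x : M, x ≠ 0 → ∀ k : ℕ, 0 < k → ρ (g ^ k) x ≠ x := by
  have hnoeth : IsNoetherianRing (MonoidAlgebra A G) :=
    Algebra.FiniteType.isNoetherianRing A (MonoidAlgebra A G)
  let : Module (MonoidAlgebra A G) M :=
    Module.compHom M (MonoidAlgebra.lift A (Module.End A M) G ρ).toRingHom
  have hsmul : ∀ (g : G) (x : M), MonoidAlgebra.of A G g • x = ρ g x := fun g x =>
    congrArg (fun f : Module.End A M => f x) (MonoidAlgebra.lift_of ρ g)
  have : IsScalarTower A (MonoidAlgebra A G) M := ⟨fun a s x => by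
    change (MonoidAlgebra.lift A (Module.End A M) G ρ (a • s)) x
      = a • (MonoidAlgebra.lift A (Module.End A M) G ρ s) x
    rw [map_smul, LinearMap.smul_apply]⟩
  have : Module.Finite (MonoidAlgebra A G) M := Module.Finite.of_restrictScalars_finite A _ M
  have hfin := associatedPrimes.finite (MonoidAlgebra A G) M
  let N : Ideal (MonoidAlgebra A G) → Subgroup G := fun P =>
    ((Ideal.Quotient.mk P).toMonoidHom.comp (MonoidAlgebra.of A G)).ker
  have hNmem : ∀ P g, g ∈ N P ↔ MonoidAlgebra.of A G g - 1 ∈ P := fun P g => by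
    rw [← Ideal.Quotient.eq]; exact Iff.rfl
  obtain ⟨g, hg⟩ := exists_forall_pow_notMem hfin.toFinset N <| by
    intro P hP hfi
    rw [Set.Finite.mem_toFinset, AssociatedPrimes.mem_iff, isAssociatedPrime_iff] at hP
    obtain ⟨hprime, x, hx⟩ := hP
    have hmem : ∀ r, r ∈ P ↔ r • x = 0 := fun r => by
      rw [hx, Submodule.mem_colon_singleton, Submodule.mem_bot]
    have hx0 : x ≠ 0 := by
      rintro rfl
      exact hprime.ne_top ((Ideal.eq_top_iff_one _).2 ((hmem 1).2 (smul_zero _)))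
    refine hρ x hx0 ?_
    have : Finite (G ⧸ N P) := Subgroup.finiteIndex_iff_finite_quotient.1 hfi
    refine (finite_range fun q : G ⧸ N P => ρ q.out x).subset ?_
    rintro _ ⟨g, rfl⟩
    refine ⟨(g : G ⧸ N P), ?_⟩
    have h1 : g⁻¹ * (g : G ⧸ N P).out ∈ N P := QuotientGroup.eq.1 (QuotientGroup.out_eq' _).symm
    rw [hNmem, hmem, sub_smul, one_smul, sub_eq_zero, hsmul] at h1
    calc ρ (g : G ⧸ N P).out x = ρ (g * (g⁻¹ * (g : G ⧸ N P).out)) x := by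
          rw [mul_inv_cancel_left]
      _ = ρ g x := by rw [map_mul, Module.End.mul_apply, h1]
  refine ⟨g, fun x hx k hk hgx => ?_⟩
  have hz : MonoidAlgebra.of A G (g ^ k) - 1 ∈
      { r : MonoidAlgebra A G | ∃ x : M, x ≠ 0 ∧ r • x = 0 } :=
    ⟨x, hx, by rw [sub_smul, one_smul, hsmul, hgx, sub_self]⟩
  rw [← biUnion_associatedPrimes_eq_zero_divisors] at hz
  obtain ⟨P, hP, hgP⟩ := mem_iUnion₂.1 hz
  exact hg P (hfin.mem_toFinset.2 hP) k hk ((hNmem _ _).2 hgP)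

section Characters

variable {A : Type*} [CommGroup A] [TopologicalSpace A]

/-- Evaluation at `a`, as a continuous complex-valued function on the dual group;
multiplicative in `a`. -/
noncomputable def evalHom (A : Type*) [CommGroup A] [TopologicalSpace A] :
    A →* C(PontryaginDual A, ℂ) where
  toFun a := ⟨fun χ => (χ a : ℂ), (by fun_prop : Continuous fun z : Circle => (z : ℂ)).comp
    ((continuous_eval_const (F := C(A, Circle)) a).comp
      (ContinuousMonoidHom.isInducing_toContinuousMap A Circle).continuous)⟩
  map_one' := by ext χ; simp
  map_mul' a b := by ext χ; simp

@[simp] lemma evalHom_apply (a : A) (χ : PontryaginDual A) : evalHom A a χ = (χ a : ℂ) := rfl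

lemma evalHom_mul_apply (a : A) (χ ψ : PontryaginDual A) :
    evalHom A a (χ * ψ) = evalHom A a χ * evalHom A a ψ := rfl

lemma star_evalHom (a : A) : star (evalHom A a) = evalHom A a⁻¹ := by
  ext χ
  simp [← Circle.coe_inv_eq_conj]

lemma dense_span_evalHom [DiscreteTopology A] :
    (Submodule.span ℂ (range (evalHom A))).topologicalClosure = ⊤ := by
  let S : StarSubalgebra ℂ C(PontryaginDual A, ℂ) :=
    { Algebra.adjoin ℂ (range (evalHom A)) with
      star_mem' := by
        change Algebra.adjoin ℂ (range (evalHom A)) ≤ star (Algebra.adjoin ℂ (range (evalHom A)))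
        refine Algebra.adjoin_le ?_
        rintro _ ⟨a, rfl⟩
        exact Algebra.subset_adjoin ⟨a⁻¹, (star_evalHom a).symm⟩ }
  have hS : S.SeparatesPoints := by
    intro χ ψ hne
    obtain ⟨a, ha⟩ := DFunLike.ne_iff.1 hne
    exact ⟨_, ⟨evalHom A a, Algebra.subset_adjoin ⟨a, rfl⟩, rfl⟩,
      fun h => ha (Circle.ext h)⟩
  have hspan : Subalgebra.toSubmodule (Algebra.adjoin ℂ (range (evalHom A)))
      = Submodule.span ℂ (range (evalHom A)) := by
    rw [Algebra.adjoin_eq_span, ← MonoidHom.coe_mrange, Submonoid.closure_eq]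
  rw [← hspan]
  exact congrArg (fun T : StarSubalgebra ℂ C(PontryaginDual A, ℂ) =>
    Subalgebra.toSubmodule T.toSubalgebra)
    (ContinuousMap.starSubalgebra_topologicalClosure_eq_top_of_separatesPoints S hS)

/-- Finite measures on the dual with equal Fourier coefficients agree on continuous functions. -/
lemma integral_eq_of_integral_evalHom_eq [DiscreteTopology A] [MeasurableSpace (PontryaginDual A)]
    [BorelSpace (PontryaginDual A)] {P Q : Measure (PontryaginDual A)} [IsFiniteMeasure P]
    [IsFiniteMeasure Q] (h : ∀ a, ∫ χ, evalHom A a χ ∂P = ∫ χ, evalHom A a χ ∂Q)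
    (f : C(PontryaginDual A, ℂ)) : ∫ χ, f χ ∂P = ∫ χ, f χ ∂Q := by
  have hintegrable : ∀ (ν : Measure (PontryaginDual A)) [IsFiniteMeasure ν]
      (f : C(PontryaginDual A, ℂ)), Integrable f ν := fun ν _ f =>
    f.continuous.integrable_of_hasCompactSupport (HasCompactSupport.of_compactSpace f)
  let I (ν : Measure (PontryaginDual A)) [IsFiniteMeasure ν] : C(PontryaginDual A, ℂ) →L[ℂ] ℂ :=
    LinearMap.mkContinuous
      { toFun := fun f => ∫ χ, f χ ∂ν
        map_add' := fun f g => integral_add (hintegrable ν f) (hintegrable ν g)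
        map_smul' := fun c f => integral_const_mul c f } (ν.real univ) fun f => by
      rw [mul_comm]
      exact norm_integral_le_of_norm_le_const (ae_of_all _ f.norm_coe_le_norm)
  have hIJ : I P = I Q := ContinuousLinearMap.ext_on
    (Submodule.dense_iff_topologicalClosure_eq_top.2 dense_span_evalHom)
    (by rintro _ ⟨a, rfl⟩; exact h a)
  exact congrArg (fun J : C(PontryaginDual A, ℂ) →L[ℂ] ℂ => J f) hIJ

/-- A multiplicative function taking a value other than `1` has integral zero. -/
lemma integral_eq_zero_of_map_mul {G : Type*} [Group G] [MeasurableSpace G] [MeasurableMul G]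
    {ν : Measure G} [ν.IsMulLeftInvariant] {f : G → ℂ} (y : G)
    (hf : ∀ x, f (y * x) = f y * f x) (hy : f y ≠ 1) : ∫ x, f x ∂ν = 0 := by
  have h := integral_mul_left_eq_self (μ := ν) f y
  simp_rw [hf] at h
  rw [integral_const_mul] at h
  have h' : (f y - 1) * ∫ x, f x ∂ν = 0 := by rw [sub_mul, h, one_mul, sub_self]
  exact (mul_eq_zero.1 h').resolve_left (sub_ne_zero.2 hy)

/-- Characters of a discrete abelian group separate points. -/
lemma exists_apply_ne_one [DiscreteTopology A] {a : A} (ha : a ≠ 1) :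
    ∃ χ : PontryaginDual A, χ a ≠ 1 := by
  obtain ⟨c, hc⟩ := CharacterModule.exists_character_apply_ne_zero_of_ne_zero
    (A := Additive A) (a := Additive.ofMul a) ha
  let ι : AddCircle (1 : ℚ) →+ AddCircle (1 : ℝ) :=
    QuotientAddGroup.map _ _ (Rat.castHom ℝ).toAddMonoidHom (by
      rintro _ ⟨n, rfl⟩
      exact ⟨n, by simp⟩)
  have hι : ∀ x, ι x = 0 → x = 0 := by
    intro x
    induction x using QuotientAddGroup.induction_on with
    | H q =>
      intro hq
      obtain ⟨n, hn⟩ := (QuotientAddGroup.eq_zero_iff _).1 hq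
      refine (QuotientAddGroup.eq_zero_iff _).2 ⟨n, ?_⟩
      have hn' : (n : ℝ) = (q : ℝ) := by simpa using hn
      simpa using (by exact_mod_cast hn' : (n : ℚ) = q)
  let e : A →* Circle := MonoidHom.mk' (fun b => AddCircle.toCircle (ι (c (Additive.ofMul b))))
    fun x y => by rw [ofMul_mul, map_add, map_add, AddCircle.toCircle_add]
  let χ : A →ₜ* Circle := ⟨e, continuous_of_discreteTopology⟩
  refine ⟨χ, fun h => hc (hι _ (AddCircle.injective_toCircle one_ne_zero ?_))⟩
  rw [AddCircle.toCircle_zero]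
  exact h

lemma integral_evalHom_eq_zero [DiscreteTopology A] [MeasurableSpace (PontryaginDual A)]
    [BorelSpace (PontryaginDual A)] (μ : Measure (PontryaginDual A)) [μ.IsHaarMeasure]
    {a : A} (ha : a ≠ 1) : ∫ χ, evalHom A a χ ∂μ = 0 := by
  obtain ⟨χ, hχ⟩ := exists_apply_ne_one ha
  exact integral_eq_zero_of_map_mul χ (evalHom_mul_apply a χ) fun h =>
    hχ (Circle.ext (h.trans Circle.coe_one.symm))

/-- A closed subgroup of the dual of a discrete group is the annihilator of its annihilator. -/
lemma mem_of_forall_apply_eq_one [DiscreteTopology A] {C : Subgroup (PontryaginDual A)}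
    (hC : IsClosed (C : Set (PontryaginDual A))) {χ : PontryaginDual A}
    (hχ : ∀ a, (∀ ψ ∈ C, ψ a = 1) → χ a = 1) : χ ∈ C := by
  by_contra hχC
  borelize (PontryaginDual A)
  have : CompactSpace C := isCompact_iff_compactSpace.1 hC.isCompact
  let ν : Measure C := Measure.haarMeasure ⊤
  have : IsProbabilityMeasure ν := ⟨Measure.haarMeasure_self⟩
  have hm₁ : Continuous fun ψ : C => (ψ : PontryaginDual A) := continuous_subtype_val
  have hm₂ : Continuous fun ψ : C => χ * (ψ : PontryaginDual A) := continuous_const.mul hm₁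
  have hmap : ∀ {p : C → PontryaginDual A}, Continuous p → ∀ f : C(PontryaginDual A, ℂ),
      ∫ x, f x ∂(ν.map p) = ∫ ψ, f (p ψ) ∂ν := fun hp f =>
    integral_map hp.measurable.aemeasurable
      (f.continuous.stronglyMeasurable_of_hasCompactSupport
        (HasCompactSupport.of_compactSpace f)).aestronglyMeasurable
  have key := integral_eq_of_integral_evalHom_eq
    (P := ν.map fun ψ : C => (ψ : PontryaginDual A))
    (Q := ν.map fun ψ : C => χ * (ψ : PontryaginDual A)) (fun a => by
      rw [hmap hm₁, hmap hm₂]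
      simp_rw [evalHom_mul_apply]
      rw [integral_const_mul]
      by_cases ha : ∀ ψ ∈ C, ψ a = 1
      · rw [evalHom_apply a χ, hχ a ha, Circle.coe_one, one_mul]
      · push Not at ha
        obtain ⟨ψ, hψ, hne⟩ := ha
        rw [integral_eq_zero_of_map_mul (ν := ν)
          (f := fun φ : C => evalHom A a (φ : PontryaginDual A)) ⟨ψ, hψ⟩
          (fun x => evalHom_mul_apply a ψ x)
          fun h => hne (Circle.ext (h.trans Circle.coe_one.symm)), mul_zero])
  have hdisj : Disjoint (C : Set (PontryaginDual A))
      ((fun ψ => χ * ψ) '' (C : Set (PontryaginDual A))) := by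
    rw [Set.disjoint_left]
    rintro _ hx ⟨ψ, hψ, rfl⟩
    exact hχC ((C.mul_mem_cancel_right hψ).1 hx)
  obtain ⟨f, hf0, hf1, -⟩ := exists_continuous_zero_one_of_isClosed hC
    (hC.isCompact.image (continuous_const_mul χ)).isClosed hdisj
  specialize key ⟨fun x => (f x : ℂ), Complex.continuous_ofReal.comp f.continuous⟩
  rw [hmap hm₁, hmap hm₂] at key
  have h0 : ∀ ψ : C, f ψ = 0 := fun ψ => hf0 ψ.2
  have h1 : ∀ ψ : C, f (χ * ψ) = 1 := fun ψ => hf1 ⟨ψ, ψ.2, rfl⟩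
  simp [h0, h1] at key

lemma dualAut_apply_apply (e : ContAut A) (χ : PontryaginDual A) (a : A) :
    (dualAut A e : MulAut (PontryaginDual A)) χ a = χ ((e : MulAut A).symm a) := rfl

end Characters

section Ergodicity

variable {A : Type*} [CommGroup A] [TopologicalSpace A] [DiscreteTopology A]
  [MeasurableSpace (PontryaginDual A)] [BorelSpace (PontryaginDual A)]
  (μ : Measure (PontryaginDual A)) [μ.IsHaarMeasure] [IsProbabilityMeasure μ]

/-- An invariant set for an automorphism without nontrivial periodic points on the discrete
side has vanishing nontrivial Fourier coefficients. -/
lemma setIntegral_evalHom_eq_zero (e : ContAut A) {a : A}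
    (ha : Function.Injective fun n : ℕ => ((e : MulAut A) ^ n) a)
    {B : Set (PontryaginDual A)} (hB : MeasurableSet B)
    (hinv : (dualAut A e : MulAut (PontryaginDual A)) '' B = B) :
    ∫ χ in B, evalHom A a χ ∂μ = 0 := by
  let α : MulAut (PontryaginDual A) := dualAut A e
  have hαc : Continuous α := ContAut.continuous (dualAut A e)
  have hαm : MeasurePreserving α μ μ :=
    MonoidHom.measurePreserving (f := α.toMonoidHom) hαc α.surjective rfl
  have hαe : MeasurableEmbedding α :=
    (Homeomorph.mk α.toEquiv hαc (ContAut.continuous_symm (dualAut A e))).measurableEmbedding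
  have hpre : α ⁻¹' B = B := by
    conv_lhs => rw [← hinv]
    exact preimage_image_eq B α.injective
  have hstep : ∀ b, ∫ χ in B, evalHom A ((e : MulAut A) b) χ ∂μ = ∫ χ in B, evalHom A b χ ∂μ := by
    intro b
    have h := hαm.setIntegral_preimage_emb hαe (evalHom A ((e : MulAut A) b)) B
    rw [hpre] at h
    rw [← h]
    refine integral_congr_ae (ae_of_all _ fun χ => ?_)
    change ((dualAut A e : MulAut (PontryaginDual A)) χ ((e : MulAut A) b) : ℂ) = (χ b : ℂ)
    rw [dualAut_apply_apply, MulEquiv.symm_apply_apply]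
  have hpow : ∀ n : ℕ, ∫ χ in B, evalHom A (((e : MulAut A) ^ n) a) χ ∂μ
      = ∫ χ in B, evalHom A a χ ∂μ := by
    intro n
    induction n with
    | zero => rfl
    | succ n ih => rw [pow_succ', MulAut.mul_apply, hstep, ih]
  have horth : Orthonormal ℂ fun b : A => ContinuousMap.toLp 2 μ ℂ (evalHom A b) := by
    classical
    rw [orthonormal_iff_ite]
    intro b c
    rw [ContinuousMap.inner_toLp]
    have hmul : ∀ χ, evalHom A c χ * (starRingEnd ℂ) (evalHom A b χ) = evalHom A (c * b⁻¹) χ := by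
      intro χ
      rw [map_mul, ← star_evalHom]
      rfl
    simp_rw [hmul]
    split_ifs with h
    · simp [h]
    · exact integral_evalHom_eq_zero μ fun h' => h (mul_inv_eq_one.1 h').symm
  have hsum := (horth.inner_products_summable
    (indicatorConstLp 2 hB (measure_ne_top μ B) (1 : ℂ))).comp_injective ha
  have hconst : ∀ n : ℕ, ‖inner ℂ (ContinuousMap.toLp 2 μ ℂ (evalHom A (((e : MulAut A) ^ n) a)))
      (indicatorConstLp 2 hB (measure_ne_top μ B) (1 : ℂ))‖ ^ 2
      = ‖∫ χ in B, evalHom A a χ ∂μ‖ ^ 2 := by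
    intro n
    rw [norm_inner_symm, L2.inner_indicatorConstLp_one, ← hpow n]
    congr 2
    exact integral_congr_ae (ae_restrict_of_ae (ContinuousMap.coeFn_toLp μ _))
  have hsum' : Summable fun _ : ℕ => ‖∫ χ in B, evalHom A a χ ∂μ‖ ^ 2 :=
    hsum.congr hconst
  simpa using (summable_const_iff _).1 hsum'

/-- The dual of an automorphism of a countable discrete group without nontrivial periodic points
is ergodic. -/
lemma ergAut_dualAut [Countable A] (e : ContAut A)
    (he : ∀ a : A, a ≠ 1 → ∀ k : ℕ, 0 < k → ((e : MulAut A) ^ k) a ≠ a) :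
    ErgAut μ (dualAut A e) := by
  intro B hB hinv
  have hinv1 : (dualAut A e : MulAut (PontryaginDual A)) '' B = B :=
    hinv (dualAut A e) ⟨1, zpow_one _⟩
  have hinj : ∀ a : A, a ≠ 1 → Function.Injective fun n : ℕ => ((e : MulAut A) ^ n) a := by
    intro a ha
    refine Function.Injective.of_lt_imp_ne fun i j hij h => he a ha (j - i) (Nat.sub_pos_of_lt hij) ?_
    apply ((e : MulAut A) ^ i).injective
    rw [← MulAut.mul_apply, ← pow_add, Nat.add_sub_cancel' hij.le]
    exact h.symm
  have : SecondCountableTopology (PontryaginDual A) :=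
    (ContinuousMonoidHom.isInducing_toContinuousMap A Circle).secondCountableTopology
  have hmeas : μ.restrict B = μ B • μ := by
    have : IsFiniteMeasure (μ B • μ) := Measure.smul_finite μ (measure_ne_top μ B)
    refine ext_of_forall_integral_eq_of_IsFiniteMeasure fun f => ?_
    have key := integral_eq_of_integral_evalHom_eq (P := μ.restrict B) (Q := μ B • μ) (fun a => by
      rw [integral_smul_measure]
      rcases eq_or_ne a 1 with rfl | ha
      · simp [Measure.real]
      · rw [setIntegral_evalHom_eq_zero μ e (hinj a ha) hB hinv1,
          integral_evalHom_eq_zero μ ha, smul_zero])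
      ⟨fun x => (f x : ℂ), Complex.continuous_ofReal.comp f.continuous⟩
    simp only [ContinuousMap.coe_mk, integral_complex_ofReal] at key
    exact_mod_cast key
  have h := congrArg (fun m : Measure (PontryaginDual A) => m B) hmeas
  simp only [Measure.restrict_apply_self, Measure.smul_apply, smul_eq_mul] at h
  by_cases h0 : μ B = 0
  · exact Or.inl h0
  · right
    rw [eq_comm, ENNReal.mul_eq_left h0 (measure_ne_top μ B)] at h
    exact h

/-- If a group of automorphisms of a discrete group acts ergodically on the dual,
every nontrivial orbit is infinite. -/
lemma infinite_orbit_of_ergSet {G : Type*} [Group G] (σ : G →* ContAut A)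
    (herg : ErgSet μ (range fun g => dualAut A (σ g))) {a : A} (ha : a ≠ 1) :
    (range fun g => (σ g : MulAut A) a).Infinite := by
  intro hfin
  have h1 : ∀ b ∈ hfin.toFinset, b ≠ 1 := by
    intro b hb hb1
    obtain ⟨g, rfl⟩ := hfin.mem_toFinset.1 hb
    exact ha ((MulEquiv.map_eq_one_iff _).1 hb1)
  let f : C(PontryaginDual A, ℂ) := ∑ b ∈ hfin.toFinset, evalHom A b
  have hfapp : ∀ χ, f χ = ∑ b ∈ hfin.toFinset, (χ b : ℂ) := fun χ => by
    simp [f, ContinuousMap.sum_apply]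
  have hf_int : ∫ χ, f χ ∂μ = 0 := by
    simp_rw [hfapp, ← evalHom_apply]
    rw [integral_finsetSum _ fun b _ =>
      (evalHom A b).continuous.integrable_of_hasCompactSupport
        (HasCompactSupport.of_compactSpace _)]
    exact Finset.sum_eq_zero fun b hb => integral_evalHom_eq_zero μ (h1 b hb)
  have hf_inv : ∀ g χ, f ((dualAut A (σ g) : MulAut (PontryaginDual A)) χ) = f χ := by
    intro g χ
    rw [hfapp, hfapp]
    simp_rw [dualAut_apply_apply]
    refine Finset.sum_nbij' (fun b => (σ g : MulAut A).symm b) (fun b => (σ g : MulAut A) b)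
      ?_ ?_ (fun b _ => MulEquiv.apply_symm_apply _ b) (fun b _ => MulEquiv.symm_apply_apply _ b)
      (fun _ _ => rfl)
    · intro b hb
      obtain ⟨h, rfl⟩ := hfin.mem_toFinset.1 hb
      exact hfin.mem_toFinset.2 ⟨g⁻¹ * h, by dsimp only; rw [map_mul, map_inv]; rfl⟩
    · intro b hb
      obtain ⟨h, rfl⟩ := hfin.mem_toFinset.1 hb
      exact hfin.mem_toFinset.2 ⟨g * h, by dsimp only; rw [map_mul]; rfl⟩
  let U : Set (PontryaginDual A) := {χ | 0 < (f χ).re}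
  have hre : Continuous fun χ => (f χ).re := Complex.continuous_re.comp f.continuous
  have hUo : IsOpen U := isOpen_lt continuous_const hre
  have hUne : U.Nonempty := by
    refine ⟨1, ?_⟩
    change 0 < (f 1).re
    rw [hfapp]
    simp only [PontryaginDual.one_apply, Circle.coe_one, Finset.sum_const, nsmul_eq_mul, mul_one,
      Complex.natCast_re, Nat.cast_pos]
    exact Finset.card_pos.2 ⟨a, hfin.mem_toFinset.2 ⟨1, by dsimp only; rw [map_one]; rfl⟩⟩
  have hU := herg U hUo.measurableSet <| by
    rintro _ ⟨g, rfl⟩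
    ext χ
    constructor
    · rintro ⟨ψ, hψ, rfl⟩
      change 0 < (f _).re
      rwa [hf_inv]
    · intro hχ
      refine ⟨(dualAut A (σ g) : MulAut (PontryaginDual A)).symm χ, ?_,
        MulEquiv.apply_symm_apply _ χ⟩
      change 0 < (f _).re
      rwa [← hf_inv g, MulEquiv.apply_symm_apply]
  have hU1 : μ U = 1 := hU.resolve_left (hUo.measure_pos μ hUne).ne'
  have hae : ∀ᵐ χ ∂μ, 0 < (f χ).re := by
    rw [← prob_compl_eq_zero_iff hUo.measurableSet] at hU1
    exact hU1
  have hintegrable : Integrable (fun χ => (f χ).re) μ :=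
    hre.integrable_of_hasCompactSupport (HasCompactSupport.of_compactSpace _)
  have hre0 : ∫ χ, (f χ).re ∂μ = 0 := by
    have h := integral_re (𝕜 := ℂ) (f.continuous.integrable_of_hasCompactSupport (μ := μ)
      (HasCompactSupport.of_compactSpace f))
    rw [hf_int] at h
    simpa using h
  rw [integral_eq_zero_iff_of_nonneg_ae (hae.mono fun _ h => h.le) hintegrable] at hre0
  obtain ⟨χ, h0, hpos⟩ := (hre0.and hae).exists
  exact hpos.ne' h0

end Ergodicity

/-- The annihilator, in a discrete module over the Laurent polynomial ring, of a subgroup of the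
dual invariant under the monomials. -/
def dualCoannihilator (R : Type*) [CommRing R] (hR : Function.Surjective (Int.cast : ℤ → R))
    (d : ℕ) (M : Type*) [AddCommGroup M] [Module (AddMonoidAlgebra R (Fin d → ℤ)) M]
    [TopologicalSpace M] [DiscreteTopology M] (C : Subgroup (PontryaginDual (Multiplicative M)))
    (hC : ∀ nv : Fin d → ℤ, ∀ χ ∈ C, (dualAut _ (monomialContAut R d M nv) :
      MulAut (PontryaginDual (Multiplicative M))) χ ∈ C) :
    Submodule (AddMonoidAlgebra R (Fin d → ℤ)) M where
  carrier := {x | ∀ χ ∈ C, χ (Multiplicative.ofAdd x) = 1}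
  zero_mem' := fun χ _ => map_one χ
  add_mem' := fun {x y} hx hy χ hχ => by rw [ofAdd_add, map_mul, hx χ hχ, hy χ hχ, one_mul]
  smul_mem' := by
    intro p x hx
    induction p using AddMonoidAlgebra.induction_linear with
    | zero => intro χ _; rw [zero_smul]; exact map_one χ
    | add p q hp hq =>
      intro χ hχ
      rw [add_smul, ofAdd_add, map_mul, hp χ hχ, hq χ hχ, one_mul]
    | single nv r =>
      obtain ⟨k, rfl⟩ := hR r
      intro χ hχ
      have hk : (AddMonoidAlgebra.single nv (k : R) : AddMonoidAlgebra R (Fin d → ℤ))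
          = k • AddMonoidAlgebra.single nv (1 : R) := by
        rw [AddMonoidAlgebra.smul_single, zsmul_one]
      have h1 := hx _ (hC (-nv) χ hχ)
      have h2 : χ (Multiplicative.ofAdd
          ((AddMonoidAlgebra.single nv (1 : R) : AddMonoidAlgebra R (Fin d → ℤ)) • x)) = 1 := by
        rw [dualAut_apply_apply] at h1
        convert! h1 using 4
        exact congrArg (fun v => (AddMonoidAlgebra.single v (1 : R) :
          AddMonoidAlgebra R (Fin d → ℤ)) • x) (neg_neg nv).symm
      rw [hk, smul_assoc, ofAdd_zsmul, map_zpow, h2, one_zpow]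

/-- A ring with cyclic additive group is additively generated by `1`. -/
lemma intCast_surjective_of_isAddCyclic (R : Type*) [CommRing R] [IsAddCyclic R] :
    Function.Surjective (Int.cast : ℤ → R) := by
  obtain ⟨g, hg⟩ := IsAddCyclic.exists_generator (α := R)
  obtain ⟨l, hl⟩ := hg 1
  obtain ⟨j, hj⟩ := hg (g * g)
  obtain hgj : g = (j : R) := by
    simp only [zsmul_eq_mul] at hl hj
    calc g = g * (l * g) := by rw [hl, mul_one]
      _ = l * (j * g) := by rw [hj]; ring
      _ = j * (l * g) := by ring
      _ = j := by rw [hl, mul_one]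
  intro r
  obtain ⟨n, rfl⟩ := hg r
  exact ⟨n * j, by rw [hgj]; simp⟩

/-- The group of module automorphisms acts on the discrete module by bicontinuous maps. -/
noncomputable def moduleContAutHom (R : Type*) [CommRing R] (d : ℕ) (M : Type*) [AddCommGroup M]
    [Module (AddMonoidAlgebra R (Fin d → ℤ)) M] [TopologicalSpace M] [DiscreteTopology M] :
    (M ≃ₗ[AddMonoidAlgebra R (Fin d → ℤ)] M) →* ContAut (Multiplicative M) :=
  MonoidHom.mk' (moduleContAut R d M) fun _ _ => rfl

/-- Theorem 5.3. Let `R` be a commutative ring whose additive group is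
cyclic, `𝐑 = R[u₁^{±1}, …, u_d^{±1}]` the Laurent polynomial ring (the group algebra of
`ℤ^d` over `R`), and `ℳ` a finitely generated `𝐑`-module with compact Pontryagin dual
`X^ℳ`. Then (1) the `ℤ^d`-action by the duals of the monomial multiplications has DCC on
`X^ℳ`; and (2) if the dual action of a finitely generated abelian group `Γ` of invertible
`𝐑`-module homomorphisms of `ℳ` is ergodic on `X^ℳ`, then the dual of some `φ ∈ Γ` is
ergodic on `X^ℳ`. -/
theorem statement19 (R : Type*) [CommRing R] (hcyc : IsAddCyclic R) (d : ℕ)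
    (M : Type*) [AddCommGroup M] [Module (AddMonoidAlgebra R (Fin d → ℤ)) M]
    [Module.Finite (AddMonoidAlgebra R (Fin d → ℤ)) M]
    [TopologicalSpace M] [DiscreteTopology M]
    [MeasurableSpace (PontryaginDual (Multiplicative M))]
    [BorelSpace (PontryaginDual (Multiplicative M))]
    (μ : Measure (PontryaginDual (Multiplicative M)))
    [μ.IsHaarMeasure] [IsProbabilityMeasure μ] :
    HasDCC (Set.range fun nv : Fin d → ℤ => dualAut _ (monomialContAut R d M nv))
    ∧ ∀ {m : ℕ} (g : Fin m → (M ≃ₗ[AddMonoidAlgebra R (Fin d → ℤ)] M)),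
        (∀ i j, g i * g j = g j * g i) →
        ∀ Γ : Subgroup (M ≃ₗ[AddMonoidAlgebra R (Fin d → ℤ)] M),
          Γ = Subgroup.closure (Set.range g) →
          ErgSet μ ((fun φ => dualAut _ (moduleContAut R d M φ)) ''
            (Γ : Set (M ≃ₗ[AddMonoidAlgebra R (Fin d → ℤ)] M))) →
          ∃ φ ∈ Γ, ErgAut μ (dualAut _ (moduleContAut R d M φ)) := by
  have hR := intCast_surjective_of_isAddCyclic R
  have hRnoeth : IsNoetherianRing R :=
    isNoetherianRing_of_surjective ℤ R (Int.castRingHom R) hR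
  have hLnoeth : IsNoetherianRing (AddMonoidAlgebra R (Fin d → ℤ)) :=
    Algebra.FiniteType.isNoetherianRing R _
  have hM : Countable M := by
    have : Countable R := hR.countable
    have : Countable (AddMonoidAlgebra R (Fin d → ℤ)) :=
      Function.Injective.countable (f := AddMonoidAlgebra.coeff)
        AddMonoidAlgebra.coeff_injective
    obtain ⟨n, f, hf⟩ := Module.Finite.exists_fin' (AddMonoidAlgebra R (Fin d → ℤ)) M
    exact hf.countable
  refine ⟨?_, ?_⟩
  · intro C hclosed hanti hinv
    have hC : ∀ n (nv : Fin d → ℤ), ∀ χ ∈ C n, (dualAut _ (monomialContAut R d M nv) :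
        MulAut (PontryaginDual (Multiplicative M))) χ ∈ C n :=
      fun n nv χ hχ => (hinv n _ ⟨nv, rfl⟩ χ).1 hχ
    obtain ⟨N, hN⟩ := monotone_stabilizes_iff_noetherian.2
      (inferInstance : IsNoetherian (AddMonoidAlgebra R (Fin d → ℤ)) M)
      ⟨fun n => dualCoannihilator R hR d M (C n) (hC n),
        monotone_nat_of_le_succ fun n _ hx χ hχ => hx χ (hanti n hχ)⟩
    refine ⟨N, fun n hn => le_antisymm (antitone_nat_of_succ_le hanti hn) fun χ hχ => ?_⟩
    refine mem_of_forall_apply_eq_one (hclosed n) fun a ha => ?_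
    have ha' : Multiplicative.toAdd a ∈ dualCoannihilator R hR d M (C n) (hC n) := ha
    exact (hN n hn).ge ha' χ hχ
  · rintro m g hg Γ rfl herg
    have hcomm : IsMulCommutative (Subgroup.closure (range g)) :=
      Subgroup.isMulCommutative_closure <| by
        rintro _ ⟨i, rfl⟩ _ ⟨j, rfl⟩
        exact hg i j
    have hfg : Group.FG (Subgroup.closure (range g)) := Group.closure_finite_fg (range g)
    have horbit : ∀ x : M, x ≠ 0 →
        (range fun φ : Subgroup.closure (range g) => φ.1 x).Infinite := fun x hx =>
      infinite_orbit_of_ergSet (A := Multiplicative M) μ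
        ((moduleContAutHom R d M).comp (Subgroup.closure (range g)).subtype)
        (by rwa [image_eq_range] at herg) (a := Multiplicative.ofAdd x) hx
    open scoped IsMulCommutative in
    obtain ⟨φ, hφ⟩ := exists_forall_pow_apply_ne
      (LinearEquiv.automorphismGroup.toLinearMapMonoidHom.comp
        (Subgroup.closure (range g)).subtype) horbit
    have : Countable (Multiplicative M) := hM
    refine ⟨φ, φ.2, ergAut_dualAut μ _ fun a ha k hk h => hφ (Multiplicative.toAdd a) ha k hk ?_⟩
    have hpow : ((moduleContAut R d M φ.1 : MulAut (Multiplicative M)) ^ k) a =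
        (moduleContAut R d M (φ.1 ^ k) : MulAut (Multiplicative M)) a := by
      rw [← Subgroup.coe_pow]
      exact congrArg (fun e : ContAut (Multiplicative M) => (e : MulAut (Multiplicative M)) a)
        (map_pow (moduleContAutHom R d M) φ.1 k).symm
    exact hpow.symm.trans h

end ErgZd
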